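/- arXiv:1208.3362 — 6 statements merged into one kernel-verified Lean document; each statement's English description precedes it below -/
import Mathlib

section
/- Let C be a left-cancellative category and S a subfamily of its morphisms. A composable path of morphisms of C is S-greedy if and only if it is S♯-greedy. -/
open CategoryTheory

universe u v

namespace GarsideTest

variable {C : Type u} [Category.{v} C]

/-- `C` is left-cancellative. -/
def LeftCancellative (C : Type u) [Category.{v} C] : Prop :=
  ∀ ⦃x y z : C⦄ (f : x ⟶ y) (g g' : y ⟶ z), f ≫ g = f ≫ g' → g = g'

/-- `f` left-divides `g`. -/
def LDiv {x y z : C} (f : x ⟶ y) (g : x ⟶ z) : Prop :=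
  ∃ r : y ⟶ z, f ≫ r = g

/-- `f` properly left-divides `g` (`f ⊏ g`). -/
def LDivStrict {x y z : C} (f : x ⟶ y) (g : x ⟶ z) : Prop :=
  LDiv f g ∧ ¬ LDiv g f

/-- `f =× g` : `g` is obtained from `f` by right-multiplication by an invertible element. -/
def EqIr {x y z : C} (f : x ⟶ y) (g : x ⟶ z) : Prop :=
  ∃ e : y ⟶ z, IsIso e ∧ f ≫ e = g

/-- The family `S♯ = S C× ∪ C×`. -/
def Sharp (S : MorphismProperty C) : MorphismProperty C :=
  fun x z g =>
    (∃ (y : C) (s : x ⟶ y) (e : y ⟶ z), S s ∧ IsIso e ∧ s ≫ e = g) ∨ IsIso g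

/-- Composable paths of morphisms of `C`. -/
inductive Path {C : Type u} [Category.{v} C] : C → C → Type (max u v)
  | nil (x : C) : Path x x
  | cons {x y z : C} (g : x ⟶ y) (p : Path y z) : Path x z

namespace Path

/-- The composite of a path. -/
def comp : ∀ {x z : C}, Path x z → (x ⟶ z)
  | _, _, nil x => 𝟙 x
  | _, _, cons g p => g ≫ p.comp

/-- The length of a path. -/
def length : ∀ {x z : C}, Path x z → ℕ
  | _, _, nil _ => 0
  | _, _, cons _ p => p.length + 1

/-- All entries of the path lie in `T`. -/
def Entries (T : MorphismProperty C) : ∀ {x z : C}, Path x z → Prop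
  | _, _, nil _ => True
  | _, _, cons g p => T g ∧ Entries T p

/-- Concatenation of paths. -/
def append : ∀ {x y z : C}, Path x y → Path y z → Path x z
  | _, _, _, nil _, q => q
  | _, _, _, cons g p, q => cons g (p.append q)

open scoped Classical in
/-- Number of non-invertible entries of a path. -/
noncomputable def ninv : ∀ {x z : C}, Path x z → ℕ
  | _, _, nil _ => 0
  | _, _, cons g p => (if IsIso g then 0 else 1) + p.ninv

end Path

/-- The length-two path `(g₁, g₂)` is `S`-greedy. -/
def Greedy2 (S : MorphismProperty C) {x y z : C} (g₁ : x ⟶ y) (g₂ : y ⟶ z) : Prop :=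
  ∀ ⦃u w : C⦄ (f : u ⟶ x) (h : u ⟶ w), S h → LDiv h (f ≫ g₁ ≫ g₂) → LDiv h (f ≫ g₁)

/-- Auxiliary: the path `g :: p` is `S`-greedy. -/
def Path.GreedyFrom (S : MorphismProperty C) : ∀ {x y z : C}, (x ⟶ y) → Path y z → Prop
  | _, _, _, _, .nil _ => True
  | _, _, _, g, .cons g' p => Greedy2 S g g' ∧ Path.GreedyFrom S g' p

/-- The path `p` is `S`-greedy. -/
def Path.Greedy (S : MorphismProperty C) : ∀ {x z : C}, Path x z → Prop
  | _, _, .nil _ => True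
  | _, _, .cons g p => Path.GreedyFrom S g p

/-- The path `p` is `S`-normal: `S`-greedy with entries in `S♯`. -/
def Path.Normal (S : MorphismProperty C) {x z : C} (p : Path x z) : Prop :=
  p.Greedy S ∧ p.Entries (Sharp S)

/-- `p` is an `S`-normal decomposition of the morphism `g`. -/
def IsNormalDecomp (S : MorphismProperty C) {x z : C} (g : x ⟶ z) (p : Path x z) : Prop :=
  p.Normal S ∧ p.comp = g

/-- `X` generates `C`. -/
def Generates (X : MorphismProperty C) : Prop :=
  ∀ ⦃x z : C⦄ (g : x ⟶ z), ∃ p : Path x z, p.Entries X ∧ p.comp = g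

/-- `S` is a Garside family in `C`. -/
def IsGarside (S : MorphismProperty C) : Prop :=
  ∀ ⦃x z : C⦄ (g : x ⟶ z), ∃ p : Path x z, IsNormalDecomp S g p

/-- `Xʳ`: morphisms expressible as composites of `r` elements of `X`. -/
def MPow (X : MorphismProperty C) (r : ℕ) : MorphismProperty C :=
  fun x z g => ∃ p : Path x z, p.Entries X ∧ p.length = r ∧ p.comp = g

/-- `X` is closed under right-complement. -/
def ClosedUnderRightComplement (X : MorphismProperty C) : Prop :=
  ∀ ⦃x y y' z : C⦄ (f : x ⟶ y) (g : x ⟶ y') (h : x ⟶ z), X f → X g →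
    LDiv f h → LDiv g h →
    ∃ (w : C) (g' : y ⟶ w) (f' : y' ⟶ w),
      X g' ∧ X f' ∧ f ≫ g' = g ≫ f' ∧ LDiv (f ≫ g') h

/-- `X` is closed under right-comultiple. -/
def ClosedUnderRightComultiple (X : MorphismProperty C) : Prop :=
  ∀ ⦃x y y' z : C⦄ (f : x ⟶ y) (g : x ⟶ y') (h : x ⟶ z), X f → X g →
    LDiv f h → LDiv g h →
    ∃ (w : C) (h' : x ⟶ w), X h' ∧ LDiv f h' ∧ LDiv g h' ∧ LDiv h' h

/-- `X` is closed under right-divisor. -/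
def ClosedUnderRightDivisor (X : MorphismProperty C) : Prop :=
  ∀ ⦃x y z : C⦄ (f : x ⟶ y) (g : y ⟶ z), X (f ≫ g) → X g

/-- `g₁` is an `S`-head of `g`. -/
def IsHead (S : MorphismProperty C) {x w y : C} (g₁ : x ⟶ w) (g : x ⟶ y) : Prop :=
  S g₁ ∧ LDiv g₁ g ∧ ∀ ⦃w' : C⦄ (h : x ⟶ w'), S h → LDiv h g → LDiv h g₁

/-- `h` is a right-lcm of `f` and `g`. -/
def IsRightLcm {x y y' w : C} (f : x ⟶ y) (g : x ⟶ y') (h : x ⟶ w) : Prop :=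
  LDiv f h ∧ LDiv g h ∧ ∀ ⦃w' : C⦄ (h' : x ⟶ w'), LDiv f h' → LDiv g h' → LDiv h h'

/-- `X` is closed under right-lcm. -/
def ClosedUnderRightLcm (X : MorphismProperty C) : Prop :=
  ∀ ⦃x y y' w : C⦄ (f : x ⟶ y) (g : x ⟶ y') (h : x ⟶ w), X f → X g →
    IsRightLcm f g h → X h

/-- `C` is right-Noetherian: proper right-divisibility is well-founded. -/
def RightNoetherian (C : Type u) [Category.{v} C] : Prop :=
  WellFounded (fun a b : Σ (x : C) (y : C), x ⟶ y =>
    ∃ (e : a.2.1 = b.2.1) (g' : b.1 ⟶ a.1), ¬ IsIso g' ∧ g' ≫ a.2.2 ≫ eqToHom e = b.2.2)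

/-- `C` is left-Noetherian: proper left-divisibility is well-founded. -/
def LeftNoetherian (C : Type u) [Category.{v} C] : Prop :=
  WellFounded (fun a b : Σ (x : C) (y : C), x ⟶ y =>
    ∃ (e : b.1 = a.1) (g' : a.2.1 ⟶ b.2.1), ¬ IsIso g' ∧ eqToHom e ≫ a.2.2 ≫ g' = b.2.2)

/-- `g` is an atom of `C`. -/
def IsAtomMor {x y : C} (g : x ⟶ y) : Prop :=
  ¬ IsIso g ∧ ∀ ⦃w : C⦄ (f : x ⟶ w) (h : w ⟶ y), f ≫ h = g → IsIso f ∨ IsIso h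

/-- The only invertible morphisms of `C` are identities. -/
def NoNontrivialInvertible (C : Type u) [Category.{v} C] : Prop :=
  ∀ ⦃x y : C⦄ (e : x ⟶ y), IsIso e → ∃ h : x = y, e = eqToHom h

/-- Deformation by invertible elements, with a connecting morphism `e` at the left end. -/
inductive DeformRel : ∀ {xf xg z : C}, (xf ⟶ xg) → Path xf z → Path xg z → Prop
  | nil (z : C) : DeformRel (𝟙 z) (.nil z) (.nil z)
  | cons {xf xg yf yg z : C} (e : xf ⟶ xg) (f : xf ⟶ yf) (g : xg ⟶ yg) (e' : yf ⟶ yg)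
      {p : Path yf z} {q : Path yg z} :
      IsIso e' → e ≫ g = f ≫ e' → DeformRel e' p q →
      DeformRel e (.cons f p) (.cons g q)
  | padF {xg yg z : C} (e : z ⟶ xg) (g : xg ⟶ yg) (e' : z ⟶ yg) {q : Path yg z} :
      IsIso e' → e ≫ g = e' → DeformRel e' (.nil z) q →
      DeformRel e (.nil z) (.cons g q)
  | padG {xf yf z : C} (e : xf ⟶ z) (f : xf ⟶ yf) (e' : yf ⟶ z) {p : Path yf z} :
      IsIso e' → e = f ≫ e' → DeformRel e' p (.nil z) →
      DeformRel e (.cons f p) (.nil z)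

/-- `p` is a `C×`-deformation of `q`. -/
def IsDeformation {x z : C} (p q : Path x z) : Prop :=
  DeformRel (𝟙 x) p q

theorem le_sharp (S : MorphismProperty C) : S ≤ Sharp S :=
  fun _ z s hs => Or.inl ⟨z, s, 𝟙 z, hs, inferInstance, Category.comp_id s⟩

theorem greedy2_sharp_iff (S : MorphismProperty C) {x y z : C} (g₁ : x ⟶ y) (g₂ : y ⟶ z) :
    Greedy2 (Sharp S) g₁ g₂ ↔ Greedy2 S g₁ g₂ := by
  refine ⟨fun H u w f h hh => H f h (le_sharp S h hh), ?_⟩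
  rintro H u w f h (⟨v, s, e, hs, he, rfl⟩ | hh) ⟨r, hr⟩
  · obtain ⟨t, ht⟩ := H f s hs ⟨e ≫ r, by simpa using hr⟩
    exact ⟨inv e ≫ t, by simpa using ht⟩
  · exact ⟨inv h ≫ f ≫ g₁, by simp⟩

theorem Path.greedyFrom_sharp_iff (S : MorphismProperty C) {x y z : C} (g : x ⟶ y)
    (p : Path y z) : p.GreedyFrom (Sharp S) g ↔ p.GreedyFrom S g := by
  induction p generalizing x with
  | nil => exact Iff.rfl
  | cons g' p ih => exact and_congr (greedy2_sharp_iff S g g') (ih g')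

theorem stmt0 {C : Type u} [Category.{v} C] (hC : LeftCancellative C)
    (S : MorphismProperty C) {x z : C} (p : Path x z) :
    p.Greedy S ↔ p.Greedy (Sharp S) := by
  cases p with
  | nil => exact Iff.rfl
  | cons g p => exact (Path.greedyFrom_sharp_iff S g p).symm

end GarsideTest
end

section
/- Let C be a left-cancellative category and S a subfamily of its morphisms such that S♯ generates C and S♯ is closed under right-complement. Then a length-two composable path (g₁, g₂) is S-greedy if and only if every h ∈ S satisfying h ⊑ g₁g₂ satisfies h ⊑ g₁. -/
open CategoryTheory

universe u v

namespace GarsideTest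

variable {C : Type u} [Category.{v} C]

theorem LDiv.trans {x y z w : C} {f : x ⟶ y} {g : x ⟶ z} {h : x ⟶ w} :
    LDiv f g → LDiv g h → LDiv f h := by
  rintro ⟨r, rfl⟩ ⟨t, rfl⟩
  exact ⟨r ≫ t, (Category.assoc _ _ _).symm⟩

theorem LDiv.comp_left {u x y z : C} (f : u ⟶ x) {g : x ⟶ y} {h : x ⟶ z} :
    LDiv g h → LDiv (f ≫ g) (f ≫ h) := by
  rintro ⟨r, rfl⟩
  exact ⟨r, Category.assoc _ _ _⟩

theorem LeftCancellative.ldiv_of_comp_left (hC : LeftCancellative C) {u x y z : C} (f : u ⟶ x)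
    {g : x ⟶ y} {h : x ⟶ z} : LDiv (f ≫ g) (f ≫ h) → LDiv g h := by
  rintro ⟨r, hr⟩
  exact ⟨r, hC f _ _ (by rw [← hr, Category.assoc])⟩

theorem LDiv.isIso_comp {x y z w : C} {f : x ⟶ y} {g : x ⟶ w} (e : y ⟶ z) [IsIso e] :
    LDiv f g → LDiv (f ≫ e) g := by
  rintro ⟨r, rfl⟩
  exact ⟨inv e ≫ r, by simp⟩

theorem ldiv_of_isIso {x y z : C} (f : x ⟶ y) (g : x ⟶ z) [IsIso f] : LDiv f g :=
  ⟨inv f ≫ g, by simp⟩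

theorem sharp_of_mem {S : MorphismProperty C} {x y : C} {s : x ⟶ y} (hs : S s) : Sharp S s :=
  Or.inl ⟨y, s, 𝟙 y, hs, inferInstance, Category.comp_id s⟩

theorem ldiv_of_sharp {S : MorphismProperty C} {x y z : C} {g : x ⟶ y} {k : x ⟶ z}
    (H : ∀ ⦃w : C⦄ (h : x ⟶ w), S h → LDiv h k → LDiv h g)
    {w : C} {h : x ⟶ w} (hh : Sharp S h) (hk : LDiv h k) : LDiv h g := by
  rcases hh with ⟨v, s, e, hs, he, rfl⟩ | he
  · exact (H s hs (LDiv.trans ⟨e, rfl⟩ hk)).isIso_comp e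
  · exact ldiv_of_isIso h g

/-- A divisor in `X` of `p.comp ≫ g`, with the entries of `p` in `X`, divides `p.comp ≫ h'` for some
divisor `h'` of `g` in `X`. -/
theorem ClosedUnderRightComplement.exists_ldiv_comp (hC : LeftCancellative C)
    {X : MorphismProperty C} (hX : ClosedUnderRightComplement X) {u x : C} (p : Path u x)
    (hp : p.Entries X) {z : C} (g : x ⟶ z) {w : C} (h : u ⟶ w) (hh : X h)
    (hd : LDiv h (p.comp ≫ g)) :
    ∃ (w' : C) (h' : x ⟶ w'), X h' ∧ LDiv h' g ∧ LDiv h (p.comp ≫ h') := by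
  induction p generalizing w with
  | nil x =>
    simp only [Path.comp, Category.id_comp] at hd ⊢
    exact ⟨w, h, hh, hd, 𝟙 w, Category.comp_id h⟩
  | cons f p ih =>
    simp only [Path.comp, Category.assoc] at hd ⊢
    obtain ⟨v, h₁, f₁, hh₁, -, heq, hdiv⟩ := hX f h _ hp.1 hh ⟨_, rfl⟩ hd
    obtain ⟨w', h', hh', hg, hc⟩ := ih hp.2 g h₁ hh₁ (hC.ldiv_of_comp_left f hdiv)
    exact ⟨w', h', hh', hg, LDiv.trans ⟨f₁, heq.symm⟩ (hc.comp_left f)⟩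

theorem stmt1 {C : Type u} [Category.{v} C] (hC : LeftCancellative C)
    (S : MorphismProperty C) (hgen : Generates (Sharp S))
    (hcl : ClosedUnderRightComplement (Sharp S))
    {x y z : C} (g₁ : x ⟶ y) (g₂ : y ⟶ z) :
    Greedy2 S g₁ g₂ ↔ ∀ ⦃w : C⦄ (h : x ⟶ w), S h → LDiv h (g₁ ≫ g₂) → LDiv h g₁ := by
  constructor
  · intro H w h hh hd
    simpa only [Category.id_comp] using H (𝟙 x) h hh (by simpa only [Category.id_comp] using hd)
  · intro H u w f h hh hd
    obtain ⟨p, hp, rfl⟩ := hgen f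
    obtain ⟨w', h', hh', hg, hc⟩ :=
      hcl.exists_ldiv_comp hC p hp (g₁ ≫ g₂) h (sharp_of_mem hh) hd
    exact hc.trans ((ldiv_of_sharp H hh' hg).comp_left p.comp)

end GarsideTest
end

section
/- Let C be a left-cancellative category and S a subfamily of its morphisms. If (g₁, g₂, …, g_q) is an S-greedy composable path, then the length-two path (g₁, g₂⋯g_q) (whose second entry is the composite of g₂, …, g_q) is S-greedy as well. -/
open CategoryTheory

universe u v

namespace GarsideTest

variable {C : Type u} [Category.{v} C]

/-- The first entry of an `S`-greedy path forms an `S`-greedy pair with the composite of the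
remaining entries. -/
theorem Path.GreedyFrom.greedy2_comp (S : MorphismProperty C) {x y z : C} (g : x ⟶ y)
    (p : Path y z) (hp : Path.GreedyFrom S g p) : Greedy2 S g p.comp := by
  induction p generalizing x with
  | nil y =>
    intro u w f h _ hdiv
    simpa only [Path.comp, Category.comp_id] using hdiv
  | cons g' p ih =>
    intro u w f h hS hdiv
    apply hp.1 f h hS
    have key := ih g' hp.2 (f ≫ g) h hS
    simp only [Path.comp, Category.assoc] at key hdiv
    exact key hdiv

theorem stmt3 {C : Type u} [Category.{v} C] (hC : LeftCancellative C)
    (S : MorphismProperty C) {x y z : C} (g₁ : x ⟶ y) (p : Path y z)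
    (hp : (Path.cons g₁ p).Greedy S) :
    Greedy2 S g₁ p.comp :=
  Path.GreedyFrom.greedy2_comp S g₁ p hp

end GarsideTest
end

section
/- Let C be a left-cancellative category and S a subfamily of its morphisms. If (g₁, …, g_q) is an S-greedy composable path and r < q, then the length-two path (g₁⋯g_r, g_{r+1}⋯g_q) is Sʳ-greedy, where Sʳ denotes the family of composites of r composable elements of S. -/
open CategoryTheory

universe u v

namespace GarsideTest

variable {C : Type u} [Category.{v} C]

theorem LDiv.of_greedyFrom {S : MorphismProperty C} {x y z : C} {g : x ⟶ y} {p : Path y z}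
    (hp : p.GreedyFrom S g) {u w : C} (f : u ⟶ x) {s : u ⟶ w} (hs : S s)
    (h : LDiv s (f ≫ g ≫ p.comp)) : LDiv s (f ≫ g) := by
  induction p generalizing x with
  | nil => simpa [Path.comp] using h
  | cons g' p ih =>
    refine hp.1 f s hs ?_
    have := ih hp.2 (f ≫ g) (by simpa [Path.comp] using h)
    simpa using this

theorem Path.comp_append {x y z : C} (p : Path x y) (q : Path y z) :
    (p.append q).comp = p.comp ≫ q.comp := by
  induction p with
  | nil => simp [Path.append, Path.comp]
  | cons g p ih => simp [Path.append, Path.comp, ih]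

theorem Path.GreedyFrom.greedy {S : MorphismProperty C} {x y z : C} {g : x ⟶ y} {p : Path y z}
    (hp : p.GreedyFrom S g) : p.Greedy S := by
  cases p with
  | nil => trivial
  | cons g' p => exact hp.2

/-- If `p₁` followed by `p₂` is `S`-greedy, then any path with entries in `S` of the same length
as `p₁` that left-divides `f ≫ p₁.comp ≫ p₂.comp` already left-divides `f ≫ p₁.comp`. -/
theorem Path.Greedy.ldiv_comp (hC : LeftCancellative C) {S : MorphismProperty C} {x y z : C}
    {p₁ : Path x y} {p₂ : Path y z} (hp : (p₁.append p₂).Greedy S) {u w : C} (f : u ⟶ x)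
    {q : Path u w} (hq : q.Entries S) (hl : q.length = p₁.length)
    (h : LDiv q.comp (f ≫ p₁.comp ≫ p₂.comp)) : LDiv q.comp (f ≫ p₁.comp) := by
  induction p₁ generalizing u w with
  | nil =>
    cases q with
    | nil => exact ⟨_, Category.id_comp _⟩
    | cons s q => simp [Path.length] at hl
  | cons g p ih =>
    cases q with
    | nil => simp [Path.length] at hl
    | cons s q =>
      obtain ⟨t, ht⟩ := h
      simp only [Path.comp, Category.assoc] at ht
      obtain ⟨f', hf'⟩ := LDiv.of_greedyFrom hp f hq.1
        ⟨q.comp ≫ t, by simp [Path.comp_append, ht]⟩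
      obtain ⟨t', ht'⟩ := ih (Path.GreedyFrom.greedy hp) f' hq.2
        (by simpa [Path.length] using hl)
        ⟨t, hC s _ _ (by rw [ht, reassoc_of% hf'])⟩
      exact ⟨t', by simp [Path.comp, ht', reassoc_of% hf']⟩

theorem stmt4 {C : Type u} [Category.{v} C] (hC : LeftCancellative C)
    (S : MorphismProperty C) {x y z : C} (p₁ : Path x y) (p₂ : Path y z) (r : ℕ)
    (hgh : (p₁.append p₂).Greedy S) (hr : p₁.length = r)
    (hrq : r < (p₁.append p₂).length) :
    Greedy2 (MPow S r) p₁.comp p₂.comp := by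
  rintro u w f _ ⟨q, hq, hl, rfl⟩ h
  exact hgh.ldiv_comp hC f hq (hl.trans hr.symm) h

end GarsideTest
end

section
/- Domino rule: let C be a left-cancellative category and S a subfamily of its morphisms. Suppose g₁, g₂, g′₁, g′₂, f₀, f₁, f₂ are morphisms of C forming a commutative diagram, i.e. f₀ g₁ = g′₁ f₁ and f₁ g₂ = g′₂ f₂. If the paths (g₁, g₂) and (g′₁, f₁) are S-greedy, then the path (g′₁, g′₂) is S-greedy as well. -/
open CategoryTheory

universe u v

namespace GarsideTest

variable {C : Type u} [Category.{v} C]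

theorem stmt7 {C : Type u} [Category.{v} C] (hC : LeftCancellative C)
    (S : MorphismProperty C) {x₀ x₁ x₂ y₀ y₁ y₂ : C}
    (g₁ : y₀ ⟶ y₁) (g₂ : y₁ ⟶ y₂) (g₁' : x₀ ⟶ x₁) (g₂' : x₁ ⟶ x₂)
    (f₀ : x₀ ⟶ y₀) (f₁ : x₁ ⟶ y₁) (f₂ : x₂ ⟶ y₂)
    (hcomm₁ : f₀ ≫ g₁ = g₁' ≫ f₁) (hcomm₂ : f₁ ≫ g₂ = g₂' ≫ f₂)
    (h₁ : Greedy2 S g₁ g₂) (h₂ : Greedy2 S g₁' f₁) :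
    Greedy2 S g₁' g₂' := by
  rintro u w f h hS ⟨r, hr⟩
  refine h₂ f h hS ?_
  have hdiv : LDiv h ((f ≫ f₀) ≫ g₁) := by
    refine h₁ (f ≫ f₀) h hS ⟨r ≫ f₂, ?_⟩
    rw [reassoc_of% hr, ← hcomm₂, ← reassoc_of% hcomm₁, Category.assoc]
  rwa [Category.assoc, hcomm₁] at hdiv

end GarsideTest
end

section
/- A subfamily X of a left-cancellative category C that is closed under right-comultiple and closed under right-divisor is closed under right-complement. -/
open CategoryTheory

universe u v

namespace GarsideTest

variable {C : Type u} [Category.{v} C]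

theorem stmt10 {C : Type u} [Category.{v} C] (hC : LeftCancellative C)
    (X : MorphismProperty C) (h1 : ClosedUnderRightComultiple X)
    (h2 : ClosedUnderRightDivisor X) :
    ClosedUnderRightComplement X := by
  intro x y y' z f g h hf hg hfh hgh
  obtain ⟨w, h', hh', ⟨g', rfl⟩, ⟨f', hf'⟩, hdiv⟩ := h1 f g h hf hg hfh hgh
  exact ⟨w, g', f', h2 f g' hh', h2 g f' (hf'.symm ▸ hh'), hf'.symm, hdiv⟩

end GarsideTest
end
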